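/- arXiv:2604.22488 — 7 statements merged into one kernel-verified Lean document; each statement's English description precedes it below -/
import Mathlib

section
/- Let 𝓜 be a nonempty subset of 𝔖 such that there exists S ∈ 𝔖 with A ≤ S for all A ∈ 𝓜, and suppose 𝓜 is upward directed: for all A, B ∈ 𝓜 there exists C ∈ 𝓜 with A ≤ C and B ≤ C. Then 𝓜 has a least upper bound G in 𝔖, and for every u ∈ 𝓗 one has (Gu,u) = sup{ (Au,u) : A ∈ 𝓜 }. -/
noncomputable section

variable {H : Type*} [NormedAddCommGroup H] [InnerProductSpace ℂ H] [CompleteSpace H]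

/-- The (real) value `(Su, u)` of the quadratic form of a bounded operator `S`
(for self-adjoint `S` the inner product `⟪Su, u⟫` is real, and equals this value). -/
def qform (S : H →L[ℂ] H) (u : H) : ℝ := (inner ℂ (S u) u : ℂ).re

/-- Löwner's partial order on bounded self-adjoint operators:
`S ≤ T` iff `(Su,u) ≤ (Tu,u)` for all `u ∈ H`. -/
def LoewnerLE (S T : H →L[ℂ] H) : Prop := ∀ u : H, qform S u ≤ qform T u

/-- The set `𝔏(𝓜)` of lower bounds of `M` within the bounded self-adjoint operators. -/
def lowerBoundsSA (M : Set (H →L[ℂ] H)) : Set (H →L[ℂ] H) :=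
  {L | IsSelfAdjoint L ∧ ∀ A ∈ M, LoewnerLE L A}

/-- `G` is the greatest element of the set `L` with respect to Löwner's order. -/
def IsGreatestSA (L : Set (H →L[ℂ] H)) (G : H →L[ℂ] H) : Prop :=
  G ∈ L ∧ ∀ X ∈ L, LoewnerLE X G

/-- `M` is a maximal element of the set `L` with respect to Löwner's order. -/
def IsMaximalSA (L : Set (H →L[ℂ] H)) (M : H →L[ℂ] H) : Prop :=
  M ∈ L ∧ ∀ X ∈ L, LoewnerLE M X → X = M

theorem qform_sub' (S T : H →L[ℂ] H) (u : H) : qform (S - T) u = qform S u - qform T u := by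
  simp [qform, inner_sub_left]

theorem loewner_iff (S T : H →L[ℂ] H) (hS : IsSelfAdjoint S) (hT : IsSelfAdjoint T) :
    LoewnerLE S T ↔ S ≤ T := by
  rw [ContinuousLinearMap.le_def, ContinuousLinearMap.isPositive_def']
  constructor
  · intro h
    refine ⟨hT.sub hS, fun u => ?_⟩
    have h1 := h u
    have h2 := qform_sub' T S u
    rw [ContinuousLinearMap.reApplyInnerSelf_apply]
    change 0 ≤ qform (T - S) u
    linarith
  · rintro ⟨-, h⟩ u
    have h1 := h u
    have h2 := qform_sub' T S u
    rw [ContinuousLinearMap.reApplyInnerSelf_apply] at h1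
    change 0 ≤ qform (T - S) u at h1
    linarith

open Filter Topology in
theorem exists_weak_limit {ι : Type*} (F : Ultrafilter ι) (A : ι → H →L[ℂ] H) (C : ℝ)
    (hC : ∀ᶠ i in (F : Filter ι), ‖A i‖ ≤ C) :
    ∃ G : H →L[ℂ] H, ∀ u v : H,
      Tendsto (fun i => inner ℂ (A i u) v) (F : Filter ι) (𝓝 (inner ℂ (G u) v)) := by
  have hb : ∀ u v : H, ∀ᶠ i in (F : Filter ι), ‖inner ℂ (A i u) v‖ ≤ C * ‖u‖ * ‖v‖ := by
    intro u v
    filter_upwards [hC] with i hi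
    refine (norm_inner_le_norm _ _).trans ?_
    gcongr
    exact (A i).le_of_opNorm_le hi u
  have hex : ∀ u v : H, ∃ z : ℂ, ‖z‖ ≤ C * ‖u‖ * ‖v‖ ∧
      Tendsto (fun i => inner ℂ (A i u) v) (F : Filter ι) (𝓝 z) := by
    intro u v
    have hc := isCompact_closedBall (0 : ℂ) (C * ‖u‖ * ‖v‖)
    obtain ⟨z, hz, hle⟩ := hc.ultrafilter_le_nhds
      (F.map (fun i => inner ℂ (A i u) v)) (by
        rw [le_principal_iff, Ultrafilter.coe_map, Filter.mem_map]
        filter_upwards [hb u v] with i hi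
        simpa using hi)
    exact ⟨z, by simpa using hz, hle⟩
  choose b hbn hbt using hex
  let B : H →ₗ⋆[ℂ] H →ₗ[ℂ] ℂ := LinearMap.mk₂'ₛₗ (starRingEnd ℂ) (RingHom.id ℂ) b
    (fun u u' v => tendsto_nhds_unique (hbt (u + u') v)
      (by simpa [inner_add_left] using (hbt u v).add (hbt u' v)))
    (fun c u v => tendsto_nhds_unique (hbt (c • u) v)
      (by simpa [inner_smul_left, mul_comm] using (hbt u v).const_mul (starRingEnd ℂ c)))
    (fun u v v' => tendsto_nhds_unique (hbt u (v + v'))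
      (by simpa [inner_add_right] using (hbt u v).add (hbt u v')))
    (fun c u v => tendsto_nhds_unique (hbt u (c • v))
      (by simpa [inner_smul_right] using (hbt u v).const_mul c))
  refine ⟨InnerProductSpace.continuousLinearMapOfBilin (B.mkContinuous₂ C hbn), fun u v => ?_⟩
  rw [InnerProductSpace.continuousLinearMapOfBilin_apply]
  exact hbt u v

/-- Theorem 2.1 (Šmul'jan/Vigier): a nonempty, upward directed set of bounded self-adjoint
operators which is bounded above in Löwner's order has a least upper bound `G` in `𝔖`, and
`(Gu,u) = sup { (Au,u) : A ∈ 𝓜 }` for every `u`. -/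
theorem stmt0 (M : Set (H →L[ℂ] H)) (hne : M.Nonempty)
    (hsa : ∀ A ∈ M, IsSelfAdjoint A)
    (hub : ∃ S : H →L[ℂ] H, IsSelfAdjoint S ∧ ∀ A ∈ M, LoewnerLE A S)
    (hdir : ∀ A ∈ M, ∀ B ∈ M, ∃ C ∈ M, LoewnerLE A C ∧ LoewnerLE B C) :
    ∃ G : H →L[ℂ] H, IsSelfAdjoint G ∧ (∀ A ∈ M, LoewnerLE A G) ∧
      (∀ S : H →L[ℂ] H, IsSelfAdjoint S → (∀ A ∈ M, LoewnerLE A S) → LoewnerLE G S) ∧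
      ∀ u : H, qform G u = sSup ((fun A => qform A u) '' M) := by
  obtain ⟨S, hS, hMS⟩ := hub
  obtain ⟨A₀, hA₀⟩ := hne
  haveI : Nonempty M := ⟨⟨A₀, hA₀⟩⟩
  haveI : IsDirectedOrder M := ⟨fun A B => by
    obtain ⟨D, hD, h1, h2⟩ := hdir A A.2 B B.2
    exact ⟨⟨D, hD⟩, (loewner_iff _ _ (hsa _ A.2) (hsa _ hD)).1 h1,
      (loewner_iff _ _ (hsa _ B.2) (hsa _ hD)).1 h2⟩⟩
  let F : Ultrafilter M := Ultrafilter.of Filter.atTop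
  have hF : (F : Filter M) ≤ Filter.atTop := Ultrafilter.of_le _
  have hge : ∀ A : M, ∀ᶠ B in (F : Filter M), A ≤ B := fun A =>
    hF (Filter.eventually_ge_atTop A)
  obtain ⟨G, hG⟩ := exists_weak_limit F (fun A : M => (A : H →L[ℂ] H)) (‖S - A₀‖ + ‖A₀‖) (by
    filter_upwards [hge ⟨A₀, hA₀⟩] with A hA
    have h1 : (0 : H →L[ℂ] H) ≤ A - A₀ := sub_nonneg.2 hA
    have h2 : (A : H →L[ℂ] H) - A₀ ≤ S - A₀ :=
      sub_le_sub_right ((loewner_iff _ _ (hsa _ A.2) hS).1 (hMS _ A.2)) _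
    have h3 := CStarAlgebra.norm_le_norm_of_nonneg_of_le h1 h2
    calc ‖(A : H →L[ℂ] H)‖ = ‖((A : H →L[ℂ] H) - A₀) + A₀‖ := by simp
      _ ≤ ‖(A : H →L[ℂ] H) - A₀‖ + ‖A₀‖ := norm_add_le _ _
      _ ≤ _ := by gcongr)
  have hq : ∀ u, Filter.Tendsto (fun A : M => qform (A : H →L[ℂ] H) u) (F : Filter M)
      (nhds (qform G u)) := fun u =>
    (Complex.continuous_re.tendsto _).comp (hG u u)
  have hGsa : IsSelfAdjoint G := by
    rw [ContinuousLinearMap.isSelfAdjoint_iff_isSymmetric]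
    intro u v
    refine tendsto_nhds_unique (hG u v) ?_
    have h := (Complex.continuous_conj.tendsto _).comp (hG v u)
    simp only [Function.comp_def, inner_conj_symm] at h
    refine h.congr fun A => ?_
    exact ((ContinuousLinearMap.isSelfAdjoint_iff_isSymmetric.1 (hsa _ A.2)) u v).symm
  have hup : ∀ A ∈ M, LoewnerLE A G := fun A hA u =>
    ge_of_tendsto (hq u) (by
      filter_upwards [hge ⟨A, hA⟩] with B hB
      exact (loewner_iff _ _ (hsa _ hA) (hsa _ B.2)).2 hB u)
  refine ⟨G, hGsa, hup, fun T _ hMT u => ?_, fun u => ?_⟩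
  · exact le_of_tendsto (hq u) (Filter.Eventually.of_forall fun A => hMT _ A.2 u)
  · symm
    refine IsLUB.csSup_eq ⟨?_, fun c hc => ?_⟩ ⟨_, A₀, hA₀, rfl⟩
    · rintro _ ⟨A, hA, rfl⟩
      exact hup A hA u
    · exact le_of_tendsto (hq u) (Filter.Eventually.of_forall fun A => hc ⟨A, A.2, rfl⟩)
end
end

section
/- Let 𝓜 be a nonempty subset of 𝔖⁺ (positive operators). (i) If there exists a dense subset 𝓓 of the unit sphere of 𝓗 such that inf{ (Au,u) : A ∈ 𝓜 } = 0 for every u ∈ 𝓓, then the zero operator is the greatest lower bound of 𝓜. (ii) If moreover 𝓜 is norm-bounded and there exists u ∈ 𝓗 such that inf{ (Au,u) : A ∈ 𝓜 } > 0, then the zero operator is not the greatest lower bound of 𝓜. -/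
noncomputable section

variable {H : Type*} [NormedAddCommGroup H] [InnerProductSpace ℂ H] [CompleteSpace H]

theorem qform_smul_vec (S : H →L[ℂ] H) (a : ℂ) (u : H) :
    qform S (a • u) = ‖a‖ ^ 2 * qform S u := by
  unfold qform
  rw [map_smul, inner_smul_left, inner_smul_right, ← mul_assoc, Complex.conj_mul',
    ← Complex.ofReal_pow, Complex.re_ofReal_mul]

theorem qform_parallel (S : H →L[ℂ] H) (v w : H) :
    qform S (v - w) + qform S (v + w) = 2 * qform S v + 2 * qform S w := by
  unfold qform
  simp only [map_sub, map_add, inner_sub_left, inner_sub_right, inner_add_left, inner_add_right,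
    Complex.sub_re, Complex.add_re]
  ring

theorem qform_le_norm (S : H →L[ℂ] H) (C : ℝ) (hC : ‖S‖ ≤ C) (w : H) :
    qform S w ≤ C * ‖w‖ ^ 2 := by
  unfold qform
  calc (inner ℂ (S w) w : ℂ).re ≤ ‖(inner ℂ (S w) w : ℂ)‖ := Complex.re_le_norm _
    _ ≤ ‖S w‖ * ‖w‖ := norm_inner_le_norm _ _
    _ ≤ (C * ‖w‖) * ‖w‖ := by
        gcongr
        exact S.le_of_opNorm_le hC w
    _ = _ := by ring

theorem qform_continuous (S : H →L[ℂ] H) : Continuous (qform S) := by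
  unfold qform
  exact Complex.continuous_re.comp (S.continuous.inner continuous_id)

theorem qform_zero_op (u : H) : qform (0 : H →L[ℂ] H) u = 0 := by simp [qform]

/-- Lemma 3.1: for a nonempty set of positive operators, (i) if the quadratic-form infimum
vanishes on a dense subset of the unit sphere then `0` is the greatest lower bound; (ii) if
moreover `M` is norm-bounded and the quadratic-form infimum is positive at some vector, then
`0` is not the greatest lower bound. -/
theorem stmt3 (M : Set (H →L[ℂ] H)) (hne : M.Nonempty)
    (hpos : ∀ A ∈ M, IsSelfAdjoint A ∧ LoewnerLE 0 A) :
    ((∃ D : Set H, D ⊆ {u : H | ‖u‖ = 1} ∧ {u : H | ‖u‖ = 1} ⊆ closure D ∧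
        ∀ u ∈ D, sInf ((fun A => qform A u) '' M) = 0) →
      IsGreatestSA (lowerBoundsSA M) 0) ∧
    ((∃ C : ℝ, ∀ A ∈ M, ‖A‖ ≤ C) →
      (∃ u : H, 0 < sInf ((fun A => qform A u) '' M)) →
      ¬ IsGreatestSA (lowerBoundsSA M) 0) := by
  have hbdd : ∀ u : H, BddBelow ((fun A => qform A u) '' M) := by
    intro u
    refine ⟨0, ?_⟩
    rintro _ ⟨A, hA, rfl⟩
    have := (hpos A hA).2 u
    rwa [qform_zero_op] at this
  constructor
  · rintro ⟨D, -, hD, hinf⟩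
    refine ⟨⟨IsSelfAdjoint.zero _, fun A hA => (hpos A hA).2⟩, ?_⟩
    rintro X ⟨-, hX⟩ u
    rw [qform_zero_op]
    have hsub : closure D ⊆ {u | qform X u ≤ 0} := by
      refine closure_minimal ?_ (isClosed_le (qform_continuous X) continuous_const)
      intro v hv
      change qform X v ≤ 0
      rw [← hinf v hv]
      refine le_csInf (hne.image _) ?_
      rintro _ ⟨A, hA, rfl⟩
      exact hX A hA v
    by_cases hu : u = 0
    · simp [hu, qform]
    have hun : ‖u‖ ≠ 0 := norm_ne_zero_iff.mpr hu
    have h1 : qform X (((‖u‖⁻¹ : ℝ) : ℂ) • u) ≤ 0 := by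
      apply hsub
      apply hD
      change ‖_‖ = 1
      rw [norm_smul, Complex.norm_real, norm_inv, norm_norm, inv_mul_cancel₀ hun]
    have h2 : u = ((‖u‖ : ℝ) : ℂ) • (((‖u‖⁻¹ : ℝ) : ℂ) • u) := by
      rw [smul_smul, ← Complex.ofReal_mul, mul_inv_cancel₀ hun, Complex.ofReal_one, one_smul]
    rw [h2, qform_smul_vec]
    exact mul_nonpos_of_nonneg_of_nonpos (by positivity) h1
  · rintro ⟨C, hC⟩ ⟨u, hu⟩ ⟨-, hG⟩
    set δ := sInf ((fun A => qform A u) '' M) with hδ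
    have hδA : ∀ A ∈ M, δ ≤ qform A u := fun A hA => csInf_le (hbdd u) ⟨A, hA, rfl⟩
    have hu0 : u ≠ 0 := by
      rintro rfl
      obtain ⟨A, hA⟩ := hne
      have := hδA A hA
      simp only [qform, map_zero, inner_zero_left, Complex.zero_re] at this
      linarith
    have hun : 0 < ‖u‖ := norm_pos_iff.mpr hu0
    let P : H →L[ℂ] H := (ℂ ∙ u).starProjection
    have hP : IsSelfAdjoint P := isSelfAdjoint_starProjection _
    let s : ℝ := δ / (2 * ‖u‖ ^ 2)
    have hs : 0 < s := by positivity
    let L : H →L[ℂ] H := (s : ℂ) • P - (C : ℂ) • (1 - P)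
    have hr : ∀ r : ℝ, IsSelfAdjoint (r : ℂ) := fun r => Complex.conj_ofReal r
    have hL : IsSelfAdjoint L :=
      ((hr s).smul hP).sub ((hr C).smul ((IsSelfAdjoint.one _).sub hP))
    have hPu : P u = u :=
      Submodule.starProjection_eq_self_iff.mpr (Submodule.mem_span_singleton_self u)
    have hLv : ∀ v, qform L v = s * ‖P v‖ ^ 2 - C * ‖v - P v‖ ^ 2 := by
      intro v
      have ho : inner ℂ (v - P v) (P v) = 0 :=
        Submodule.starProjection_inner_eq_zero v (P v) (Submodule.starProjection_apply_mem _ v)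
      have ho' : inner ℂ (P v) (v - P v) = 0 := inner_eq_zero_symm.mp ho
      have e1 : (inner ℂ (P v) v : ℂ) = inner ℂ (P v) (P v) := by
        rw [inner_sub_right] at ho'
        exact sub_eq_zero.mp ho'
      have e2 : (inner ℂ (v - P v) v : ℂ) = inner ℂ (v - P v) (v - P v) := by
        rw [inner_sub_right (v - P v) v (P v), ho, sub_zero]
      have e3 : L v = (s : ℂ) • P v - (C : ℂ) • (v - P v) := rfl
      unfold qform
      rw [e3, inner_sub_left, inner_smul_left, inner_smul_left, e1, e2, Complex.conj_ofReal,
        Complex.conj_ofReal, Complex.sub_re, Complex.re_ofReal_mul, Complex.re_ofReal_mul,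
        inner_self_eq_norm_sq_to_K, inner_self_eq_norm_sq_to_K]
      norm_cast
    have hlow : L ∈ lowerBoundsSA M := by
      refine ⟨hL, fun A hA v => ?_⟩
      rw [hLv]
      obtain ⟨a, ha⟩ := Submodule.mem_span_singleton.mp
        (Submodule.starProjection_apply_mem (ℂ ∙ u) v)
      change a • u = P v at ha
      have h1 := qform_parallel A v (v - P v)
      have h2 := qform_le_norm A C (hC A hA) (v - P v)
      have h3 := (hpos A hA).2 (v + (v - P v))
      rw [qform_zero_op] at h3
      rw [sub_sub_cancel] at h1
      have h4 : qform A (P v) = ‖a‖ ^ 2 * qform A u := by rw [← ha, qform_smul_vec]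
      have h5 : s * ‖P v‖ ^ 2 = ‖a‖ ^ 2 * δ / 2 := by
        rw [← ha, norm_smul]
        simp only [s]
        field_simp
      have h6 : ‖a‖ ^ 2 * δ ≤ ‖a‖ ^ 2 * qform A u :=
        mul_le_mul_of_nonneg_left (hδA A hA) (by positivity)
      linarith
    have h := hG L hlow u
    rw [hLv, qform_zero_op, hPu, sub_self, norm_zero] at h
    have : 0 < s * ‖u‖ ^ 2 := by positivity
    linarith
end
end

section
/- Let 𝓜 be a nonempty subset of 𝔖⁺. (i) If ⋂_{A ∈ 𝓜} Ran(A^{1/2}) = {0}, then the zero operator is the only positive lower bound of 𝓜. (ii) If, additionally, 𝓜 is a finite set and ⋂_{A ∈ 𝓜} Ran(A^{1/2}) ≠ {0}, then there exists a positive lower bound of 𝓜 different from 0. -/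
set_option synthInstance.maxHeartbeats 400000
set_option maxHeartbeats 800000

noncomputable section

variable {H : Type*} [NormedAddCommGroup H] [InnerProductSpace ℂ H] [CompleteSpace H]

theorem aux_nonneg (A : H →L[ℂ] H) (h1 : IsSelfAdjoint A) (h2 : LoewnerLE 0 A) : 0 ≤ A := by
  rw [ContinuousLinearMap.nonneg_iff_isPositive, ContinuousLinearMap.isPositive_def']
  refine ⟨h1, fun u => ?_⟩
  have := h2 u
  simpa [qform, ContinuousLinearMap.reApplyInnerSelf] using this

theorem aux_sa (A : H →L[ℂ] H) : ∀ x y : H,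
    inner ℂ (CFC.sqrt A x) y = inner ℂ x (CFC.sqrt A y) := by
  have h : IsSelfAdjoint (CFC.sqrt A) := IsSelfAdjoint.of_nonneg (CFC.sqrt_nonneg A)
  intro x y
  exact h.isSymmetric x y

theorem aux_inner (A : H →L[ℂ] H) (hA : 0 ≤ A) (x y : H) :
    inner ℂ (A x) y = inner ℂ (CFC.sqrt A x) (CFC.sqrt A y) := by
  have h : CFC.sqrt A (CFC.sqrt A x) = A x := by
    have := CFC.sqrt_mul_sqrt_self A hA
    exact congrArg (fun T : H →L[ℂ] H => T x) this
  rw [← h, aux_sa]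

theorem aux_qform (A : H →L[ℂ] H) (hA : 0 ≤ A) (x : H) :
    qform A x = ‖CFC.sqrt A x‖ ^ 2 := by
  unfold qform
  rw [aux_inner A hA]
  exact (norm_sq_eq_re_inner (𝕜 := ℂ) (CFC.sqrt A x)).symm

theorem aux_range (B : H →L[ℂ] H) (hB : ∀ x y : H, inner ℂ (B x) y = inner ℂ x (B y))
    (y : H) (C : ℝ) (h : ∀ u, ‖(inner ℂ y u : ℂ)‖ ≤ C * ‖B u‖) : y ∈ Set.range ⇑B := by
  obtain ⟨g, hg⟩ := LinearMap.exists_rightInverse_of_surjective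
    (B : H →ₗ[ℂ] H).rangeRestrict (LinearMap.range_rangeRestrict _)
  have hg' : ∀ w, B (g w) = w := fun w => by
    have := congrArg (fun T => ((T w : LinearMap.range (B : H →ₗ[ℂ] H)) : H)) hg
    simpa using this
  let φ := LinearMap.mkContinuous ((innerSL ℂ y : H →ₗ[ℂ] ℂ) ∘ₗ g) C (fun w => by
    have := h (g w)
    rw [hg'] at this
    simpa using this)
  obtain ⟨ψ, hψ, -⟩ := exists_extension_norm_eq _ φ
  let z := (InnerProductSpace.toDual ℂ H).symm ψ
  refine ⟨z, ?_⟩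
  refine ext_inner_right ℂ fun u => ?_
  rw [hB, InnerProductSpace.toDual_symm_apply]
  have h1 := hψ ⟨B u, LinearMap.mem_range_self (B : H →ₗ[ℂ] H) u⟩
  have h2 : ψ (B u) = inner ℂ y (g ⟨B u, LinearMap.mem_range_self (B : H →ₗ[ℂ] H) u⟩) := h1
  rw [h2, ← sub_eq_zero, ← inner_sub_right, ← norm_le_zero_iff]
  refine (h _).trans ?_
  rw [map_sub, hg']
  simp

/-- Lemma 4.1: for a nonempty set `M` of positive operators, (i) if the intersection of the
ranges of the square roots `A^{1/2}`, `A ∈ M`, is `{0}`, then `0` is the only positive lower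
bound of `M`; (ii) if moreover `M` is finite and this intersection is not `{0}`, there is a
nonzero positive lower bound. -/
theorem stmt6 (M : Set (H →L[ℂ] H)) (hne : M.Nonempty)
    (hpos : ∀ A ∈ M, IsSelfAdjoint A ∧ LoewnerLE 0 A) :
    ((⋂ A ∈ M, Set.range ⇑(CFC.sqrt A)) = {0} →
      ∀ L : H →L[ℂ] H, IsSelfAdjoint L → LoewnerLE 0 L → (∀ A ∈ M, LoewnerLE L A) →
        L = 0) ∧
    (M.Finite → (⋂ A ∈ M, Set.range ⇑(CFC.sqrt A)) ≠ {0} →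
      ∃ L : H →L[ℂ] H, IsSelfAdjoint L ∧ LoewnerLE 0 L ∧ (∀ A ∈ M, LoewnerLE L A) ∧
        L ≠ 0) := by
  constructor
  · intro hI L hL1 hL2 hL3
    have hL := aux_nonneg L hL1 hL2
    ext x
    have hx : L x ∈ (⋂ A ∈ M, Set.range ⇑(CFC.sqrt A)) := by
      simp only [Set.mem_iInter]
      intro A hA
      have hA0 := aux_nonneg A (hpos A hA).1 (hpos A hA).2
      refine aux_range _ (aux_sa A) _ ‖CFC.sqrt L x‖ fun u => ?_
      rw [aux_inner L hL]
      refine (norm_inner_le_norm _ _).trans ?_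
      refine mul_le_mul_of_nonneg_left ?_ (norm_nonneg _)
      have := hL3 A hA u
      rw [aux_qform L hL, aux_qform A hA0] at this
      exact le_of_sq_le_sq this (norm_nonneg _)
    rw [hI] at hx
    simpa using hx
  · intro hfin hI
    have h0 : (0 : H) ∈ (⋂ A ∈ M, Set.range ⇑(CFC.sqrt A)) := by
      simp only [Set.mem_iInter]
      exact fun A _ => ⟨0, map_zero _⟩
    obtain ⟨y, hy, hy0⟩ : ∃ y ∈ (⋂ A ∈ M, Set.range ⇑(CFC.sqrt A)), y ≠ 0 := by
      by_contra! hcon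
      exact hI (Set.Subset.antisymm (fun y hy => hcon y hy) (by simpa using h0))
    have hz : ∀ A : H →L[ℂ] H, ∃ z, A ∈ M → CFC.sqrt A z = y := by
      intro A
      by_cases hA : A ∈ M
      · obtain ⟨z, hz⟩ := Set.mem_iInter₂.1 hy A hA
        exact ⟨z, fun _ => hz⟩
      · exact ⟨0, fun h => absurd h hA⟩
    choose z hz using hz
    obtain ⟨K, hK⟩ := (hfin.image fun A => ‖z A‖).bddAbove
    have hK' : ∀ A ∈ M, ‖z A‖ ≤ |K| + 1 := fun A hA =>
      (hK ⟨A, hA, rfl⟩).trans (by linarith [le_abs_self K])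
    have hC : 0 < |K| + 1 := by positivity
    generalize |K| + 1 = C at hK' hC
    let w : H := ((C⁻¹ : ℝ) : ℂ) • y
    have hw : w ≠ 0 := smul_ne_zero (by exact_mod_cast (inv_pos.2 hC).ne') hy0
    have hq : ∀ u, qform (InnerProductSpace.rankOne ℂ w w) u = ‖(inner ℂ w u : ℂ)‖ ^ 2 := by
      intro u
      unfold qform
      rw [InnerProductSpace.rankOne_apply, inner_smul_left, RCLike.conj_mul]
      norm_cast
    refine ⟨InnerProductSpace.rankOne ℂ w w, ?_, ?_, ?_, ?_⟩
    · exact InnerProductSpace.adjoint_rankOne w w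
    · intro u
      rw [hq]
      simp [qform]
      try positivity
    · intro A hA u
      rw [hq, aux_qform A (aux_nonneg A (hpos A hA).1 (hpos A hA).2)]
      refine pow_le_pow_left₀ (norm_nonneg _) ?_ 2
      have h1 : ‖(inner ℂ y u : ℂ)‖ ≤ C * ‖CFC.sqrt A u‖ := by
        rw [← hz A hA, aux_sa]
        exact (norm_inner_le_norm _ _).trans
          (mul_le_mul_of_nonneg_right (hK' A hA) (norm_nonneg _))
      have h2 : ‖(inner ℂ w u : ℂ)‖ = C⁻¹ * ‖(inner ℂ y u : ℂ)‖ := by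
        simp only [w]
        rw [inner_smul_left, norm_mul, RCLike.norm_conj, Complex.norm_real,
          Real.norm_of_nonneg (inv_pos.2 hC).le]
      rw [h2, inv_mul_le_iff₀ hC]
      exact h1
    · intro h
      have := congrArg (fun T : H →L[ℂ] H => T w) h
      simp [hw] at this
end
end

section
/- Let 𝓜 be a nonempty subset of 𝔖 bounded from below, let u be a unit vector of 𝓗, let α := inf{ (Au,u) : A ∈ 𝓜 }, and set 𝓜_u := { A ∈ 𝓜 : (Au,u) = α } and 𝔏_u := { L ∈ 𝔏(𝓜) : (Lu,u) = α }. If 𝓜_u is nonempty and 𝔏_u is nonempty, then Au = Bu for all A, B ∈ 𝓜_u. -/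
noncomputable section

variable {H : Type*} [NormedAddCommGroup H] [InnerProductSpace ℂ H] [CompleteSpace H]

/-- A positive self-adjoint operator whose quadratic form vanishes at `u` kills `u`. -/
theorem aux_kill (T : H →L[ℂ] H) (hT : IsSelfAdjoint T) (hpos : ∀ v, 0 ≤ qform T v) (u : H)
    (h0 : qform T u = 0) : T u = 0 := by
  have hsym : ∀ x y : H, inner ℂ (T x) y = inner ℂ x (T y) := fun x y => hT.isSymmetric x y
  have key : ∀ t : ℝ, 0 ≤ 2 * t * ‖T u‖ ^ 2 + t ^ 2 * qform T (T u) := by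
    intro t
    have h := hpos (u + (t : ℂ) • T u)
    have e : qform T (u + (t : ℂ) • T u)
        = qform T u + 2 * t * ‖T u‖ ^ 2 + t ^ 2 * qform T (T u) := by
      have h1 : (inner ℂ (T u) (T u) : ℂ) = ((‖T u‖ ^ 2 : ℝ) : ℂ) := by
        rw [inner_self_eq_norm_sq_to_K]; push_cast; rfl
      have h2 : (inner ℂ (T (T u)) u : ℂ) = ((‖T u‖ ^ 2 : ℝ) : ℂ) := by
        rw [hsym, h1]
      unfold qform
      rw [map_add, map_smul, inner_add_left, inner_add_right, inner_add_right]
      simp only [inner_smul_left, inner_smul_right, h1, h2, Complex.conj_ofReal,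
        Complex.add_re, Complex.re_ofReal_mul, Complex.ofReal_re]
      ring
    rw [e, h0] at h
    linarith
  have hb := hpos (T u)
  have ha : 0 ≤ ‖T u‖ ^ 2 := by positivity
  generalize qform T (T u) = b at *
  by_contra hne
  have hpa : 0 < ‖T u‖ ^ 2 := by
    have := norm_pos_iff.mpr hne
    positivity
  generalize ‖T u‖ ^ 2 = a at *
  have k := key (-(a / (b + 1)))
  have hc : 0 < a / (b + 1) := by positivity
  have hd : a / (b + 1) * (b + 1) = a := by field_simp
  generalize a / (b + 1) = c at *
  subst hd
  nlinarith [mul_pos hc hc, mul_nonneg (mul_pos hc hc).le hb]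

/-- Theorem 4.5: let `u` be a unit vector, `α = inf {(Au,u) : A ∈ M}`,
`M_u = {A ∈ M : (Au,u) = α}` and `𝔏_u = {L ∈ 𝔏(M) : (Lu,u) = α}`. If `M_u` and `𝔏_u` are
both nonempty, then `Au = Bu` for all `A, B ∈ M_u`. -/
theorem stmt11 (M : Set (H →L[ℂ] H)) (hne : M.Nonempty)
    (hsa : ∀ A ∈ M, IsSelfAdjoint A)
    (hbdd : (lowerBoundsSA M).Nonempty)
    (u : H) (hu : ‖u‖ = 1)
    (hMu : {A ∈ M | qform A u = sInf ((fun A => qform A u) '' M)}.Nonempty)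
    (hLu : {L ∈ lowerBoundsSA M | qform L u = sInf ((fun A => qform A u) '' M)}.Nonempty) :
    ∀ A ∈ M, ∀ B ∈ M,
      qform A u = sInf ((fun A => qform A u) '' M) →
      qform B u = sInf ((fun A => qform A u) '' M) →
      A u = B u := by
  obtain ⟨L, ⟨hL, hLM⟩, hLa⟩ := hLu
  have sub : ∀ (A : H →L[ℂ] H) (v : H), qform (A - L) v = qform A v - qform L v := by
    intro A v
    simp [qform, inner_sub_left]
  have main : ∀ A ∈ M, qform A u = sInf ((fun A => qform A u) '' M) → A u = L u := by
    intro A hA hAa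
    have := aux_kill (A - L) ((hsa A hA).sub hL)
      (fun v => by rw [sub]; exact sub_nonneg.mpr (hLM A hA v)) u
      (by rw [sub, hAa, hLa, sub_self])
    exact sub_eq_zero.mp this
  intro A hA B hB hAa hBa
  rw [main A hA hAa, main B hB hBa]
end
end

section
/- For every set 𝓜 = {A, B} of two bounded self-adjoint operators on 𝓗, there exists a maximal lower bound M of 𝓜 such that ker(A−M) + ker(B−M) = 𝓗. -/
noncomputable section

variable {H : Type*} [NormedAddCommGroup H] [InnerProductSpace ℂ H] [CompleteSpace H]

theorem psd_apply_eq_zero (Y : H →L[ℂ] H) (hY : IsSelfAdjoint Y) (hn : ∀ u, 0 ≤ qform Y u)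
    (u : H) (hu : qform Y u ≤ 0) : Y u = 0 := by
  have hp : 0 ≤ Y := by
    rw [ContinuousLinearMap.nonneg_iff_isPositive, ContinuousLinearMap.isPositive_def']
    exact ⟨hY, fun x => hn x⟩
  obtain ⟨S, hS⟩ := CStarAlgebra.nonneg_iff_eq_star_mul_self.mp hp
  have h1 : ∀ x, Y x = ContinuousLinearMap.adjoint S (S x) := fun x => by rw [hS]; rfl
  have h2 : qform Y u = ‖S u‖ ^ 2 := by
    rw [qform, h1, ContinuousLinearMap.adjoint_inner_left]
    exact inner_self_eq_norm_sq (𝕜 := ℂ) (S u)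
  have h3 : S u = 0 := by
    rw [← norm_eq_zero]
    have := norm_nonneg (S u)
    nlinarith
  rw [h1, h3, map_zero]

/-- Corollary 5.2: for any two bounded self-adjoint operators `A, B` there is a maximal
lower bound `Mo` of `{A, B}` with `ker(A - Mo) + ker(B - Mo) = H`. -/
theorem stmt14 (A B : H →L[ℂ] H) (hA : IsSelfAdjoint A) (hB : IsSelfAdjoint B) :
    ∃ Mo : H →L[ℂ] H, IsMaximalSA (lowerBoundsSA {A, B}) Mo ∧
      LinearMap.ker ((A - Mo : H →L[ℂ] H) : H →ₗ[ℂ] H) ⊔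
        LinearMap.ker ((B - Mo : H →L[ℂ] H) : H →ₗ[ℂ] H) = ⊤ := by
  have hD : IsSelfAdjoint (A - B) := hA.sub hB
  obtain ⟨P, N, hP, hN, hPN, hsub⟩ : ∃ P N : H →L[ℂ] H, P.IsPositive ∧ N.IsPositive ∧
      P * N = 0 ∧ P - N = A - B :=
    ⟨(A - B)⁺, (A - B)⁻,
      (ContinuousLinearMap.nonneg_iff_isPositive _).mp (CFC.posPart_nonneg _),
      (ContinuousLinearMap.nonneg_iff_isPositive _).mp (CFC.negPart_nonneg _),
      CFC.posPart_mul_negPart _, CFC.posPart_sub_negPart _ hD⟩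
  have eA : A - (A - P) = P := by abel
  have eB : B - (A - P) = N := by
    have : N = P - (A - B) := by rw [← hsub]; abel
    rw [this]; abel
  have hqP : ∀ u, 0 ≤ qform P u := fun u => hP.re_inner_nonneg_left u
  have hqN : ∀ u, 0 ≤ qform N u := fun u => hN.re_inner_nonneg_left u
  have hker : LinearMap.ker (P : H →ₗ[ℂ] H) ⊔ LinearMap.ker (N : H →ₗ[ℂ] H) = ⊤ := by
    have hc : IsClosed ((LinearMap.ker (P : H →ₗ[ℂ] H) : Submodule ℂ H) : Set H) :=
      P.isClosed_ker
    haveI : CompleteSpace (LinearMap.ker (P : H →ₗ[ℂ] H)) := hc.completeSpace_coe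
    rw [eq_top_iff, ← Submodule.sup_orthogonal_of_hasOrthogonalProjection
      (K := LinearMap.ker (P : H →ₗ[ℂ] H))]
    refine sup_le_sup le_rfl fun v hv => ?_
    have hm : N (N v) ∈ LinearMap.ker (P : H →ₗ[ℂ] H) := by
      have := congrArg (fun T : H →L[ℂ] H => T (N v)) hPN
      simpa using this
    have h0 := (Submodule.mem_orthogonal _ v).mp hv _ hm
    rw [hN.inner_left_eq_inner_right] at h0
    simpa using h0
  refine ⟨A - P, ⟨⟨hA.sub hP.isSelfAdjoint, ?_⟩, ?_⟩, by rw [eA, eB]; exact hker⟩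
  · rintro C (rfl | rfl) u
    · have := hqP u
      rw [← eA, qform_sub'] at this
      linarith
    · have := hqN u
      rw [← eB, qform_sub'] at this
      linarith
  · rintro X ⟨hX, hXl⟩ hMX
    have hXA := hXl A (by simp)
    have hXB := hXl B (by simp)
    have hY : IsSelfAdjoint (X - (A - P)) := hX.sub (hA.sub hP.isSelfAdjoint)
    have hYn : ∀ u, 0 ≤ qform (X - (A - P)) u := fun u => by
      rw [qform_sub']; linarith [hMX u]
    rw [← sub_eq_zero]
    have hle : LinearMap.ker (P : H →ₗ[ℂ] H) ⊔ LinearMap.ker (N : H →ₗ[ℂ] H) ≤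
        LinearMap.ker ((X - (A - P) : H →L[ℂ] H) : H →ₗ[ℂ] H) := by
      refine sup_le (fun u hu => ?_) (fun u hu => ?_)
      · have hz : qform P u = 0 := by
          have : P u = 0 := hu
          simp [qform, this]
        rw [← eA, qform_sub'] at hz
        refine psd_apply_eq_zero _ hY hYn u ?_
        rw [qform_sub']; linarith [hXA u]
      · have hz : qform N u = 0 := by
          have : N u = 0 := hu
          simp [qform, this]
        rw [← eB, qform_sub'] at hz
        refine psd_apply_eq_zero _ hY hYn u ?_
        rw [qform_sub']; linarith [hXB u]
    rw [hker] at hle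
    ext u
    exact hle (Submodule.mem_top (x := u))
end
end

section
/- Let A ∈ 𝔖 with ker(A) = {0}, let 𝓜 := {A, 0}, and let 𝓚 be a closed subspace of 𝓗. (i) If there exists a maximal lower bound M of 𝓜 satisfying Mu = Au for all u ∈ 𝓚, then (Au,u) < 0 for all u ∈ 𝓚 \ {0}. (ii) If there exists a maximal lower bound M of 𝓜 with 𝓚 ⊆ ker(M), then (Au,u) > 0 for all u ∈ 𝓚 \ {0}. -/
noncomputable section

variable {H : Type*} [NormedAddCommGroup H] [InnerProductSpace ℂ H] [CompleteSpace H]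

theorem aux_zero (T : H →L[ℂ] H) (hT : IsSelfAdjoint T) (hp : ∀ u, 0 ≤ qform T u) (u : H)
    (hu : qform T u = 0) : T u = 0 := by
  have hsym : ∀ x y : H, inner ℂ (T x) y = inner ℂ x (T y) := hT.isSymmetric
  have key : ∀ t : ℝ, qform T (u + (t : ℂ) • T u)
      = 2 * t * ‖T u‖ ^ 2 + t ^ 2 * qform T (T u) := by
    intro t
    have h1 : (inner ℂ (T (T u)) u : ℂ) = inner ℂ (T u) (T u) := hsym _ _
    have h2 : (inner ℂ (T u) (T u) : ℂ) = ((‖T u‖ ^ 2 : ℝ) : ℂ) := by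
      rw [inner_self_eq_norm_sq_to_K]; norm_cast
    have h3 : (inner ℂ (T u) u : ℂ).re = 0 := hu
    unfold qform
    simp only [map_add, map_smul, inner_add_left, inner_add_right, inner_smul_left,
      inner_smul_right, Complex.conj_ofReal, h1, h2, Complex.add_re, Complex.re_ofReal_mul,
      Complex.ofReal_re, h3]
    ring
  have hb := hp (T u)
  set b := qform T (T u) with hbdef
  set a := ‖T u‖ ^ 2 with ha
  have h := hp (u + ((-(a / (b + 1)) : ℝ) : ℂ) • T u)
  rw [key] at h
  have hb1 : 0 < b + 1 := by linarith
  obtain ⟨s, hs⟩ : ∃ s, s = a / (b + 1) := ⟨_, rfl⟩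
  have has : a = s * (b + 1) := by rw [hs]; field_simp
  rw [← hs, has] at h
  have hs0 : s = 0 := by
    have h' : s ^ 2 * (b + 2) ≤ 0 := by nlinarith
    have : s ^ 2 ≤ 0 := by nlinarith [sq_nonneg s]
    exact pow_eq_zero_iff (two_ne_zero) |>.1 (le_antisymm this (sq_nonneg s))
  rw [hs0, zero_mul] at has
  exact norm_eq_zero.1 (pow_eq_zero_iff two_ne_zero |>.1 has)

/-- Lemma 5.4: let `A` be self-adjoint with trivial kernel, `𝓜 = {A, 0}` and `K` a closed
subspace. (i) If some maximal lower bound `Mo` of `𝓜` agrees with `A` on `K`, then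
`(Au,u) < 0` for all nonzero `u ∈ K`; (ii) if some maximal lower bound `Mo` of `𝓜`
vanishes on `K`, then `(Au,u) > 0` for all nonzero `u ∈ K`. -/
theorem stmt15 (A : H →L[ℂ] H) (hA : IsSelfAdjoint A)
    (hker : LinearMap.ker (A : H →ₗ[ℂ] H) = ⊥)
    (K : Submodule ℂ H) (hK : IsClosed (K : Set H)) :
    ((∃ Mo, IsMaximalSA (lowerBoundsSA {A, 0}) Mo ∧ ∀ u ∈ K, Mo u = A u) →
      ∀ u ∈ K, u ≠ 0 → qform A u < 0) ∧
    ((∃ Mo, IsMaximalSA (lowerBoundsSA {A, 0}) Mo ∧ ∀ u ∈ K, Mo u = 0) →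
      ∀ u ∈ K, u ≠ 0 → 0 < qform A u) := by
  have hinj : ∀ u, A u = 0 → u = 0 := fun u hu => by
    have : u ∈ LinearMap.ker (A : H →ₗ[ℂ] H) := hu
    rw [hker] at this
    exact this
  have q0 : ∀ u : H, qform (0 : H →L[ℂ] H) u = 0 := fun u => by simp [qform]
  constructor
  · rintro ⟨M, ⟨⟨hM, hle⟩, -⟩, hMA⟩ u hu hu0
    have h0 : ∀ v, qform M v ≤ qform (0 : H →L[ℂ] H) v := hle 0 (by simp)
    have heq : qform M u = qform A u := by unfold qform; rw [hMA u hu]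
    have hle0 : qform A u ≤ 0 := by rw [← heq, ← q0 u]; exact h0 u
    refine lt_of_le_of_ne hle0 fun hz => hu0 (hinj u ?_)
    have := aux_zero (0 - M) ((IsSelfAdjoint.zero _).sub hM)
      (fun v => by rw [qform_sub']; linarith [h0 v]) u (by rw [qform_sub', q0, heq, hz, sub_zero])
    rw [← hMA u hu]
    simpa using this
  · rintro ⟨M, ⟨⟨hM, hle⟩, -⟩, hM0⟩ u hu hu0
    have h0 : ∀ v, qform M v ≤ qform A v := hle A (by simp)
    have heq : qform M u = 0 := by unfold qform; rw [hM0 u hu]; simp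
    refine lt_of_le_of_ne (heq ▸ h0 u) fun hz => hu0 (hinj u ?_)
    have := aux_zero (A - M) (hA.sub hM)
      (fun v => by rw [qform_sub']; linarith [h0 v]) u (by rw [qform_sub', heq, ← hz, sub_zero])
    simpa [hM0 u hu] using this
end
end

section
/- Let 𝓜 be a nonempty subset of 𝔖, bounded from below, whose elements commute pairwise (AB = BA for all A, B ∈ 𝓜). Then the set 𝔏^{com}(𝓜) := { L ∈ 𝔏(𝓜) : LA = AL for all A ∈ 𝓜 } has a greatest element. -/
noncomputable section

variable {H : Type*} [NormedAddCommGroup H] [InnerProductSpace ℂ H] [CompleteSpace H]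

open Filter Topology in
theorem wot_limit {ι : Type*} (f : Ultrafilter ι) (Y : ι → (H →L[ℂ] H)) (C : ℝ)
    (hC : ∀ᶠ i in (f : Filter ι), ‖Y i‖ ≤ C) :
    ∃ G : H →L[ℂ] H, ∀ u v : H,
      Tendsto (fun i => inner ℂ (Y i u) v) (f : Filter ι) (𝓝 (inner ℂ (G u) v)) := by
  have hb : ∀ u v : H, ∀ᶠ i in (f : Filter ι), ‖inner ℂ (Y i u) v‖ ≤ C * ‖u‖ * ‖v‖ := by
    intro u v
    filter_upwards [hC] with i hi
    refine (norm_inner_le_norm _ _).trans ?_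
    gcongr
    exact (Y i).le_of_opNorm_le hi u
  have hlim : ∀ u v : H, ∃ b : ℂ, Tendsto (fun i => inner ℂ (Y i u) v) (f : Filter ι) (𝓝 b) := by
    intro u v
    have hk := isCompact_closedBall (0 : ℂ) (C * ‖u‖ * ‖v‖)
    obtain ⟨b, -, hb'⟩ := hk.ultrafilter_le_nhds (f.map (fun i => inner ℂ (Y i u) v)) (by
      rw [le_principal_iff]
      change ∀ᶠ i in (f : Filter ι), _
      filter_upwards [hb u v] with i hi
      simpa using hi)
    exact ⟨b, hb'⟩
  choose B hB using hlim
  let L : H →ₗ⋆[ℂ] H →ₗ[ℂ] ℂ := LinearMap.mk₂'ₛₗ (starRingEnd ℂ) (RingHom.id ℂ) B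
    (fun u u' v => tendsto_nhds_unique (hB _ _)
      (((hB u v).add (hB u' v)).congr fun i => by simp))
    (fun c u v => tendsto_nhds_unique (hB _ _)
      (((hB u v).const_mul _).congr fun i => by simp [mul_comm]))
    (fun u v v' => tendsto_nhds_unique (hB _ _)
      (((hB u v).add (hB u v')).congr fun i => by simp))
    (fun c u v => tendsto_nhds_unique (hB _ _)
      (((hB u v).const_mul _).congr fun i => by simp))
  let L' : H →L⋆[ℂ] H →L[ℂ] ℂ := L.mkContinuous₂ C
    (fun u v => le_of_tendsto (hB u v).norm (hb u v))
  refine ⟨InnerProductSpace.continuousLinearMapOfBilin L', fun u v => ?_⟩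
  rw [InnerProductSpace.continuousLinearMapOfBilin_apply]
  exact hB u v

theorem loewner_iff_s16 {X Y : H →L[ℂ] H} (hX : IsSelfAdjoint X) (hY : IsSelfAdjoint Y) :
    LoewnerLE X Y ↔ X ≤ Y := by
  rw [ContinuousLinearMap.le_def, ContinuousLinearMap.isPositive_def']
  simp only [hY.sub hX, true_and, LoewnerLE, qform, ContinuousLinearMap.reApplyInnerSelf]
  simp [inner_sub_left]

theorem abs_sub_le_add {a b : H →L[ℂ] H} (ha : 0 ≤ a) (hb : 0 ≤ b) (h : Commute a b) :
    CFC.abs (a - b) ≤ a + b := by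
  have hab : 0 ≤ a * b := Commute.mul_nonneg ha hb h
  have h1 : CFC.abs (a - b) ≤ CFC.abs (a + b) := by
    refine CFC.sqrt_le_sqrt _ _ ?_
    rw [((IsSelfAdjoint.of_nonneg ha).sub (IsSelfAdjoint.of_nonneg hb)).star_eq,
      ((IsSelfAdjoint.of_nonneg ha).add (IsSelfAdjoint.of_nonneg hb)).star_eq, ← sub_nonneg]
    have : (a + b) * (a + b) - (a - b) * (a - b) = a * b + a * b + (a * b + a * b) := by
      have := h.eq
      simp only [mul_add, add_mul, mul_sub, sub_mul, this]
      abel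
    rw [this]
    exact add_nonneg (add_nonneg hab hab) (add_nonneg hab hab)
  rwa [CFC.abs_of_nonneg (a + b) (add_nonneg ha hb)] at h1

theorem sa_le_abs {a : H →L[ℂ] H} (ha : IsSelfAdjoint a) : a ≤ CFC.abs a := by
  rw [← sub_nonneg, CFC.abs_sub_self a ha]
  exact nsmul_nonneg (CFC.negPart_nonneg a) 2

open Filter Topology in
/-- Theorem 6.3a: for a nonempty set `M` of pairwise commuting bounded self-adjoint
operators which is bounded from below, the set `𝔏^{com}(M)` of lower bounds of `M`
commuting with every element of `M` has a greatest element. -/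
theorem stmt16 (M : Set (H →L[ℂ] H)) (hne : M.Nonempty)
    (hsa : ∀ A ∈ M, IsSelfAdjoint A)
    (hbdd : (lowerBoundsSA M).Nonempty)
    (hcomm : ∀ A ∈ M, ∀ B ∈ M, A * B = B * A) :
    ∃ G, IsGreatestSA {L ∈ lowerBoundsSA M | ∀ A ∈ M, L * A = A * L} G := by
  set K : Set (H →L[ℂ] H) := {L ∈ lowerBoundsSA M | ∀ A ∈ M, L * A = A * L} with hK
  let S : Set (H →L[ℂ] H) := {Y | IsSelfAdjoint Y ∧
    (∀ T, IsSelfAdjoint T → (∀ A ∈ M, Commute T A) → Commute Y T) ∧ ∀ X ∈ K, X ≤ Y}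
  have hMS : ∀ A ∈ M, A ∈ S := fun A hA => ⟨hsa A hA, fun T _ hT => (hT A hA).symm,
    fun X hX => (loewner_iff_s16 hX.1.1 (hsa A hA)).1 (hX.1.2 A hA)⟩
  -- a scalar lower bound
  obtain ⟨L₀, hL₀, hL₀'⟩ := hbdd
  let Z : H →L[ℂ] H := -algebraMap ℝ (H →L[ℂ] H) ‖L₀‖
  have hZsa : IsSelfAdjoint Z := ((IsSelfAdjoint.all ‖L₀‖).algebraMap _).neg
  have hZL : Z ≤ L₀ := hL₀.neg_algebraMap_norm_le_self
  have hZK : Z ∈ K := by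
    refine ⟨⟨hZsa, fun A hA => ?_⟩, fun A hA => ?_⟩
    · exact (loewner_iff_s16 hZsa (hsa A hA)).2
        (hZL.trans ((loewner_iff_s16 hL₀ (hsa A hA)).1 (hL₀' A hA)))
    · exact (Commute.neg_left (Algebra.commute_algebraMap_left ‖L₀‖ A)).eq
  -- directedness
  have hdir : ∀ Y₁ ∈ S, ∀ Y₂ ∈ S, ∃ Y ∈ S, Y ≤ Y₁ ∧ Y ≤ Y₂ := by
    rintro Y₁ ⟨h1, h1c, h1K⟩ Y₂ ⟨h2, h2c, h2K⟩
    have h12 : Commute Y₁ Y₂ := h1c Y₂ h2 fun A hA =>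
      h2c A (hsa A hA) fun B hB => hcomm A hA B hB
    have habs : IsSelfAdjoint (CFC.abs (Y₁ - Y₂)) := IsSelfAdjoint.of_nonneg (CFC.abs_nonneg _)
    have two : ∀ W : H →L[ℂ] H, (1 / 2 : ℝ) • (W + W) = W := fun W => by
      rw [← two_smul ℝ W, smul_smul]; norm_num
    have hhalf : (0 : ℝ) ≤ 1 / 2 := by norm_num
    refine ⟨(1 / 2 : ℝ) • (Y₁ + Y₂ - CFC.abs (Y₁ - Y₂)), ⟨?_, ?_, ?_⟩, ?_, ?_⟩
    · exact (IsSelfAdjoint.all (1 / 2 : ℝ)).smul ((h1.add h2).sub habs)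
    · intro T hT hTM
      have c1 := h1c T hT hTM
      have c2 := h2c T hT hTM
      have c3 : Commute (CFC.abs (Y₁ - Y₂)) T :=
        Commute.cfcAbs_left (c1.sub_left c2) (by rw [hT.star_eq]; exact c1.sub_left c2)
      exact ((c1.add_left c2).sub_left c3).smul_left _
    · intro X hX
      have c1 : Commute Y₁ X := h1c X hX.1.1 hX.2
      have c2 : Commute Y₂ X := h2c X hX.1.1 hX.2
      have hc : Commute (Y₁ - X) (Y₂ - X) :=
        (h12.sub_left c2.symm).sub_right (c1.sub_left (Commute.refl X))
      have := abs_sub_le_add (sub_nonneg.2 (h1K X hX)) (sub_nonneg.2 (h2K X hX)) hc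
      rw [sub_sub_sub_cancel_right] at this
      rw [← two X]
      refine smul_le_smul_of_nonneg_left ?_ hhalf
      rw [← sub_nonneg] at this ⊢
      convert this using 1
      abel
    · have := sa_le_abs (h2.sub h1)
      rw [← CFC.abs_neg, neg_sub] at this
      conv_rhs => rw [← two Y₁]
      refine smul_le_smul_of_nonneg_left ?_ hhalf
      rw [← sub_nonneg] at this ⊢
      convert this using 1
      abel
    · have := sa_le_abs (h1.sub h2)
      conv_rhs => rw [← two Y₂]
      refine smul_le_smul_of_nonneg_left ?_ hhalf
      rw [← sub_nonneg] at this ⊢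
      convert this using 1
      abel
  obtain ⟨A₀, hA₀⟩ := hne
  have : Nonempty S := ⟨⟨A₀, hMS A₀ hA₀⟩⟩
  have : IsCodirectedOrder S := ⟨fun a b => by
    obtain ⟨Y, hY, h1, h2⟩ := hdir a a.2 b b.2
    exact ⟨⟨Y, hY⟩, h1, h2⟩⟩
  let f : Ultrafilter S := Ultrafilter.of atBot
  have hf : (f : Filter S) ≤ atBot := Ultrafilter.of_le _
  have hle : ∀ Y ∈ S, ∀ᶠ i : S in (f : Filter S), (i : H →L[ℂ] H) ≤ Y := fun Y hY =>
    hf (eventually_le_atBot (⟨Y, hY⟩ : S))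
  obtain ⟨G, hG⟩ := wot_limit f (fun i : S => (i : H →L[ℂ] H)) (‖A₀ - Z‖ + ‖Z‖) (by
    filter_upwards [hle A₀ (hMS A₀ hA₀)] with i hi
    have h0 : ‖(i : H →L[ℂ] H) - Z‖ ≤ ‖A₀ - Z‖ :=
      CStarAlgebra.norm_le_norm_of_nonneg_of_le (sub_nonneg.2 (i.2.2.2 Z hZK))
        (sub_le_sub_right hi Z)
    calc ‖(i : H →L[ℂ] H)‖ = ‖((i : H →L[ℂ] H) - Z) + Z‖ := by rw [sub_add_cancel]
      _ ≤ _ := norm_add_le _ _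
      _ ≤ _ := by gcongr)
  have hq : ∀ u, Tendsto (fun i : S => qform (i : H →L[ℂ] H) u) (f : Filter S) (𝓝 (qform G u)) :=
    fun u => (Complex.continuous_re.tendsto _).comp (hG u u)
  have hGsa : IsSelfAdjoint G := by
    rw [ContinuousLinearMap.isSelfAdjoint_iff_isSymmetric]
    intro u v
    refine tendsto_nhds_unique (hG u v) ?_
    have := (Complex.continuous_conj.tendsto _).comp (hG v u)
    simp only [ContinuousLinearMap.coe_coe]
    rw [inner_conj_symm] at this
    refine this.congr fun i => ?_
    simp only [Function.comp, inner_conj_symm]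
    exact ((ContinuousLinearMap.isSelfAdjoint_iff_isSymmetric.1 i.2.1) u v).symm
  refine ⟨G, ⟨⟨hGsa, fun A hA u => ?_⟩, fun A hA => ?_⟩, fun X hX u => ?_⟩
  · refine le_of_tendsto (hq u) ?_
    filter_upwards [hle A (hMS A hA)] with i hi
    exact (loewner_iff_s16 i.2.1 (hsa A hA)).2 hi u
  · ext u
    refine ext_inner_right ℂ fun v => ?_
    have hs := ContinuousLinearMap.isSelfAdjoint_iff_isSymmetric.1 (hsa A hA)
    refine tendsto_nhds_unique (hG (A u) v) ?_
    have e : inner ℂ ((A * G) u) v = inner ℂ (G u) (A v) := hs (G u) v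
    rw [e]
    refine (hG u (A v)).congr fun i => ?_
    have hc : Commute (i : H →L[ℂ] H) A := i.2.2.1 A (hsa A hA) fun B hB => hcomm A hA B hB
    have e2 : (i : H →L[ℂ] H) (A u) = A ((i : H →L[ℂ] H) u) := DFunLike.congr_fun hc.eq u
    rw [e2]
    exact (hs _ v).symm
  · refine ge_of_tendsto (hq u) (Eventually.of_forall fun i => ?_)
    exact (loewner_iff_s16 hX.1.1 i.2.1).2 (i.2.2.2 X hX) u
end
end
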